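/- A word w over the alphabet {e, b, b̄} satisfies w →* w' for some word w' containing only the letter e (possibly the empty word) if and only if the subword of w consisting of its letters b and b̄ is a Dyck word (with b as opening letter). -/

import Mathlib

/-- The three-letter alphabet `{e, b, b̄}`; `bb` stands for `b̄`. -/
inductive B : Type
  | e | b | bb
  deriving DecidableEq

/-- The local closure rewriting relation:
`u·b·e^k·b̄·v → u·e·v` for all words `u, v` and all `k ≥ 0`. -/
def Rw (w w' : List B) : Prop :=
  ∃ u v : List B, ∃ k : ℕ,
    w = u ++ [B.b] ++ List.replicate k B.e ++ [B.bb] ++ v ∧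
    w' = u ++ [B.e] ++ v

/-- A word is irreducible if no rewriting step applies to it. -/
def IrreducibleWord (w : List B) : Prop := ¬ ∃ w', Rw w w'

/-- `w` is a Dyck word with opening letter `o` and closing letter `c`. -/
def IsDyck (o c : B) (w : List B) : Prop :=
  w.count o = w.count c ∧ ∀ ℓ : ℕ, (w.take ℓ).count c ≤ (w.take ℓ).count o

def HD : ℕ → List B → Prop
  | n, [] => n = 0
  | n, B.e :: w => HD n w
  | n, B.b :: w => HD (n+1) w
  | 0, B.bb :: _ => False
  | n+1, B.bb :: w => HD n w

inductive Stk : ℕ → List B → Prop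
  | zero (k : ℕ) : Stk 0 (List.replicate k B.e)
  | succ (n k : ℕ) (s : List B) : Stk n s → Stk (n+1) (s ++ [B.b] ++ List.replicate k B.e)

theorem Stk.app {n : ℕ} {s : List B} (h : Stk n s) : Stk n (s ++ [B.e]) := by
  cases h with
  | zero k => rw [← List.replicate_succ']; exact Stk.zero _
  | succ n k s h =>
    rw [List.append_assoc, ← List.replicate_succ']; exact Stk.succ _ _ _ h

theorem HD_reduces (w : List B) : ∀ (n : ℕ) (s : List B), Stk n s → HD n w →
    ∃ w', Relation.ReflTransGen Rw (s ++ w) w' ∧ ∀ x ∈ w', x = B.e := by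
  induction w with
  | nil =>
    intro n s hs h
    simp only [HD] at h
    subst h
    cases hs with
    | zero k => exact ⟨_, Relation.ReflTransGen.refl, by simp⟩
  | cons a w ih =>
    intro n s hs h
    cases a with
    | e => simpa using ih n _ hs.app (by simpa [HD] using h)
    | b =>
      simpa using ih (n+1) _ (Stk.succ n 0 s hs) (by simpa [HD] using h)
    | bb =>
      cases hs with
      | zero k => simp [HD] at h
      | succ n k s hs =>
        obtain ⟨w', h1, h2⟩ := ih n _ hs.app (by simpa [HD] using h)
        exact ⟨w', Relation.ReflTransGen.head ⟨s, w, k, by simp, rfl⟩ h1, h2⟩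

theorem HD_rep (k : ℕ) (v : List B) (n : ℕ) : HD n (List.replicate k B.e ++ v) ↔ HD n v := by
  induction k with
  | zero => simp
  | succ k ih => simpa [List.replicate_succ, HD] using ih

theorem HD_step (u v : List B) (k : ℕ) : ∀ n,
    HD n (u ++ [B.b] ++ List.replicate k B.e ++ [B.bb] ++ v) ↔ HD n (u ++ [B.e] ++ v) := by
  induction u with
  | nil => intro n; simp [HD, HD_rep]
  | cons a u ih =>
    intro n
    simp only [List.append_assoc, List.cons_append, List.nil_append] at ih ⊢
    cases a with
    | e => simpa [HD] using ih n
    | b => simpa [HD] using ih (n+1)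
    | bb =>
      cases n with
      | zero => simp [HD]
      | succ n => simpa [HD] using ih n

theorem HD_dyck (w : List B) : ∀ n, HD n w ↔
    (n + (w.filter (fun x => x == B.b || x == B.bb)).count B.b
      = (w.filter (fun x => x == B.b || x == B.bb)).count B.bb ∧
    ∀ l : ℕ, ((w.filter (fun x => x == B.b || x == B.bb)).take l).count B.bb ≤
      n + ((w.filter (fun x => x == B.b || x == B.bb)).take l).count B.b) := by
  induction w with
  | nil => intro n; simp [HD]
  | cons a w ih =>
    intro n
    cases a with
    | e => simpa [HD] using ih n
    | b =>
      have hf : (B.b :: w).filter (fun x => x == B.b || x == B.bb)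
        = B.b :: w.filter (fun x => x == B.b || x == B.bb) := by simp
      rw [hf, HD, ih]
      generalize w.filter (fun x => x == B.b || x == B.bb) = f
      refine and_congr (by simp; omega) ⟨fun h l => ?_, fun h l => ?_⟩
      · cases l with
        | zero => simp
        | succ l => have := h l; simp; omega
      · have := h (l+1); simp at this; omega
    | bb =>
      have hf : (B.bb :: w).filter (fun x => x == B.b || x == B.bb)
        = B.bb :: w.filter (fun x => x == B.b || x == B.bb) := by simp
      rw [hf]
      cases n with
      | zero =>
        simp only [HD, false_iff]
        rintro ⟨-, h⟩
        have := h 1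
        simp at this
      | succ n =>
        rw [HD, ih]
        generalize w.filter (fun x => x == B.b || x == B.bb) = f
        refine and_congr (by simp; omega) ⟨fun h l => ?_, fun h l => ?_⟩
        · cases l with
          | zero => simp
          | succ l => have := h l; simp; omega
        · have := h (l+1); simp at this; omega

theorem reduces_to_all_e_iff_dyck (w : List B) :
    (∃ w', Relation.ReflTransGen Rw w w' ∧ ∀ x ∈ w', x = B.e) ↔
      IsDyck B.b B.bb (w.filter (fun x => x == B.b || x == B.bb)) := by
  have key := HD_dyck w 0
  simp only [Nat.zero_add] at key
  unfold IsDyck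
  rw [← key]
  clear key
  constructor
  · rintro ⟨w', h, hw⟩
    induction h using Relation.ReflTransGen.head_induction_on with
    | refl =>
      have := List.eq_replicate_of_mem hw
      rw [this]
      have h2 := HD_rep w'.length [] 0
      rw [List.append_nil] at h2
      exact h2.2 rfl
    | head h _ ih =>
      obtain ⟨u, v, k, rfl, rfl⟩ := h
      exact (HD_step u v k 0).2 ih
  · intro h
    simpa using HD_reduces w 0 [] (Stk.zero 0) h
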